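/- arXiv:2506.00780 — 2 statements merged into one kernel-verified Lean document; each statement's English description precedes it below -/
import Mathlib

section
/- Let 𝒬 be a finite type, Y a nonempty finite type, K : 𝒬 → (PMF on Y) a kernel, w a PMF on 𝒬, and q★ ∈ 𝒬 with w q★ > 0. Let M be the mixture PMF on Y defined by M y = ∑_q w q * (K q) y, and write P = K q★. Assume the disjoint-support hypothesis: for every q ≠ q★ and every y ∈ Y, (K q★) y > 0 implies (K q) y = 0. Then the restricted Kullback–Leibler divergence D⁺(M‖P) = ∑_{y : P y > 0} M y * log (M y / P y) equals (w q★) * log (w q★). -/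
/-- Under the disjoint-support hypothesis, the restricted KL divergence
`D⁺(M‖P) = ∑_{y : P y > 0} M y * log (M y / P y)` (with `P = K q★`)
equals `w q★ * log (w q★)`. -/
theorem restricted_kl_mixture_component_eq {𝒬 : Type*} [Fintype 𝒬]
    {Y : Type*} [Fintype Y] [Nonempty Y]
    (K : 𝒬 → Y → ℝ)
    (hK0 : ∀ q y, 0 ≤ K q y) (hK1 : ∀ q, ∑ y, K q y = 1)
    (w : 𝒬 → ℝ) (hw0 : ∀ q, 0 ≤ w q) (hw1 : ∑ q, w q = 1)
    (qs : 𝒬) (hqs : 0 < w qs)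
    (M : Y → ℝ) (hM : ∀ y, M y = ∑ q, w q * K q y)
    (hdisj : ∀ q, q ≠ qs → ∀ y, 0 < K qs y → K q y = 0) :
    ∑ y ∈ Finset.univ.filter (fun y => 0 < K qs y),
        M y * Real.log (M y / K qs y)
      = w qs * Real.log (w qs) := by
  have h1 : ∀ y, 0 < K qs y → M y = w qs * K qs y := by
    intro y hy
    rw [hM]
    refine Finset.sum_eq_single qs (fun q _ hq => ?_) (fun h => absurd (Finset.mem_univ _) h)
    rw [hdisj q hq y hy, mul_zero]
  have h2 : ∑ y ∈ Finset.univ.filter (fun y => 0 < K qs y), K qs y = 1 := by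
    rw [← hK1 qs]
    refine Finset.sum_filter_of_ne (fun y _ hy => ?_)
    exact lt_of_le_of_ne (hK0 qs y) (Ne.symm hy)
  have h3 : ∀ y ∈ Finset.univ.filter (fun y => 0 < K qs y),
      M y * Real.log (M y / K qs y) = (w qs * Real.log (w qs)) * K qs y := by
    intro y hy
    have hy' : 0 < K qs y := (Finset.mem_filter.mp hy).2
    rw [h1 y hy', mul_div_cancel_right₀ _ hy'.ne']
    ring
  rw [Finset.sum_congr rfl h3, ← Finset.mul_sum, h2, mul_one]
end

section
/- Let 𝒬 be a finite type, Y a nonempty finite type, K : 𝒬 → (PMF on Y) a kernel, w a PMF on 𝒬, and q★ ∈ 𝒬 with w q★ > 0. Let M be the mixture PMF on Y defined by M y = ∑_q w q * (K q) y, and write P = K q★. Assume the disjoint-support hypothesis: for every q ≠ q★ and every y ∈ Y, (K q★) y > 0 implies (K q) y = 0. Then the restricted entropy H⁺(M) = -∑_{y : P y > 0} M y * log (M y) equals -(w q★) * log (w q★) + (w q★) * H(P). -/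
/-- Under the disjoint-support hypothesis, the restricted entropy
`H⁺(M) = -∑_{y : P y > 0} M y * log (M y)` (with `P = K q★`) equals
`-(w q★) * log (w q★) + (w q★) * H(P)`. -/
theorem restricted_entropy_mixture_eq {𝒬 : Type*} [Fintype 𝒬]
    {Y : Type*} [Fintype Y] [Nonempty Y]
    (K : 𝒬 → Y → ℝ)
    (hK0 : ∀ q y, 0 ≤ K q y) (hK1 : ∀ q, ∑ y, K q y = 1)
    (w : 𝒬 → ℝ) (hw0 : ∀ q, 0 ≤ w q) (hw1 : ∑ q, w q = 1)
    (qs : 𝒬) (hqs : 0 < w qs)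
    (M : Y → ℝ) (hM : ∀ y, M y = ∑ q, w q * K q y)
    (hdisj : ∀ q, q ≠ qs → ∀ y, 0 < K qs y → K q y = 0) :
    (-∑ y ∈ Finset.univ.filter (fun y => 0 < K qs y), M y * Real.log (M y))
      = -(w qs) * Real.log (w qs)
        + w qs * (-∑ y, K qs y * Real.log (K qs y)) := by
  have key : ∑ y ∈ Finset.univ.filter (fun y => 0 < K qs y), M y * Real.log (M y)
      = ∑ y, (w qs * Real.log (w qs) * K qs y + w qs * (K qs y * Real.log (K qs y))) := by
    rw [Finset.sum_filter]
    refine Finset.sum_congr rfl fun y _ => ?_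
    by_cases h : 0 < K qs y
    · have hMy : M y = w qs * K qs y := by
        rw [hM y]
        refine Finset.sum_eq_single qs (fun q _ hq => ?_) (fun hn => absurd (Finset.mem_univ qs) hn)
        rw [hdisj q hq y h, mul_zero]
      rw [if_pos h, hMy, Real.log_mul hqs.ne' h.ne']
      ring
    · have h0 : K qs y = 0 := le_antisymm (not_lt.mp h) (hK0 qs y)
      rw [if_neg h, h0]
      ring
  rw [key, Finset.sum_add_distrib, ← Finset.mul_sum, ← Finset.mul_sum, hK1 qs]
  ring
end
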